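/- Under the critically loaded scaling, for each i ∈ {1,…,C} one has (1 − ρ_i^{(k)})/(1 − ρ^{(k)}) → 1 as k → ∞, where ρ_i^{(k)} := λ^{(k)} α_i d_i / s_i^{(k)} (well defined for all k large enough, since s_i^{(k)} → ∞). -/

import Mathlib

open Finset Filter Topology MeasureTheory

/-- Erlang's loss formula (Erlang-B): blocking probability of an M/GI/s/s queue
with offered load `a`. -/
noncomputable def erlangB (s : ℕ) (a : ℝ) : ℝ :=
  (a ^ s / Nat.factorial s) / ∑ ℓ ∈ Finset.range (s + 1), a ^ ℓ / Nat.factorial ℓ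

/-- Standard normal density φ. -/
noncomputable def stdGaussianPDF (x : ℝ) : ℝ :=
  Real.exp (-x ^ 2 / 2) / Real.sqrt (2 * Real.pi)

/-- Standard normal cumulative distribution function Φ. -/
noncomputable def stdGaussianCDF (x : ℝ) : ℝ :=
  ∫ t in Set.Iic x, stdGaussianPDF t

/-- Relative demand of class `i`: ϱ_i = α_i d_i n_i. -/
noncomputable def relDemand {C : ℕ} (n : Fin C → ℕ) (α d : Fin C → ℝ) (i : Fin C) : ℝ :=
  α i * d i * n i

/-- Total relative demand: ϱ = ∑ i, ϱ_i. -/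
noncomputable def totDemand {C : ℕ} (n : Fin C → ℕ) (α d : Fin C → ℝ) : ℝ :=
  ∑ i, relDemand n α d i

/-- ψ_k = sup { x ∈ [0,1] : k - ∑_i ⌊x · k ϱ_i/(n_i f_k ϱ)⌋ n_i f_k ≥ max_i n_i f_k },
with the convention `sSup ∅ = 0` of real numbers. -/
noncomputable def psi {C : ℕ} (n : Fin C → ℕ) (α d : Fin C → ℝ) (f : ℕ → ℕ) (k : ℕ) : ℝ :=
  sSup {x : ℝ | x ∈ Set.Icc (0 : ℝ) 1 ∧
    (k : ℝ) - ∑ i, (⌊x * ((k : ℝ) * relDemand n α d i /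
        ((n i : ℝ) * (f k : ℝ) * totDemand n α d))⌋ : ℝ) * ((n i : ℝ) * (f k : ℝ))
      ≥ ((Finset.univ.sup (fun i => n i * f k) : ℕ) : ℝ)}

/-- Number of class-`i` "virtual servers": s_i^(k) = ⌊ψ_k · k ϱ_i/(n_i f_k ϱ)⌋. -/
noncomputable def srv {C : ℕ} (n : Fin C → ℕ) (α d : Fin C → ℝ) (f : ℕ → ℕ)
    (i : Fin C) (k : ℕ) : ℕ :=
  ⌊psi n α d f k * ((k : ℝ) * relDemand n α d i /
      ((n i : ℝ) * (f k : ℝ) * totDemand n α d))⌋₊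

/-- θ_i = θ √(ϱ_i/(n_i ϱ)). -/
noncomputable def thetaI {C : ℕ} (n : Fin C → ℕ) (α d : Fin C → ℝ) (θ : ℝ) (i : Fin C) : ℝ :=
  θ * Real.sqrt (relDemand n α d i / ((n i : ℝ) * totDemand n α d))

theorem totDemand_pos {C : ℕ} (hC : 0 < C) {n : Fin C → ℕ} (hn : ∀ i, 0 < n i)
    {α d : Fin C → ℝ} (hα : ∀ i, 0 < α i) (hd : ∀ i, 0 < d i) : 0 < totDemand n α d := by
  refine Finset.sum_pos (fun i _ => ?_) ⟨⟨0, hC⟩, Finset.mem_univ _⟩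
  exact mul_pos (mul_pos (hα i) (hd i)) (Nat.cast_pos.2 (hn i))

theorem psi_le_one {C : ℕ} (n : Fin C → ℕ) (α d : Fin C → ℝ) (f : ℕ → ℕ) (k : ℕ) :
    psi n α d f k ≤ 1 :=
  Real.sSup_le (fun _ hx => hx.1.2) zero_le_one

theorem one_sub_le_psi {C : ℕ} {n : Fin C → ℕ} (hn : ∀ i, 0 < n i) {α d : Fin C → ℝ}
    (hT : 0 < totDemand n α d) {f : ℕ → ℕ} {k : ℕ} (hf : 0 < f k) (hk : 0 < k)
    (h : ((Finset.univ.sup n : ℕ) : ℝ) * f k ≤ k) :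
    1 - ((Finset.univ.sup n : ℕ) : ℝ) * f k / k ≤ psi n α d f k := by
  have hk' : (0 : ℝ) < k := Nat.cast_pos.2 hk
  have hf' : (0 : ℝ) < f k := Nat.cast_pos.2 hf
  refine le_csSup ⟨1, fun _ hx => hx.1.2⟩ ⟨⟨?_, ?_⟩, ?_⟩
  · rw [sub_nonneg, div_le_one hk']
    exact h
  · rw [sub_le_self_iff]
    positivity
  · set x : ℝ := 1 - ((Finset.univ.sup n : ℕ) : ℝ) * f k / k with hx
    have hmax : ((Finset.univ.sup (fun i => n i * f k) : ℕ) : ℝ)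
        ≤ ((Finset.univ.sup n : ℕ) : ℝ) * f k := by
      exact_mod_cast Finset.sup_le fun i hi => Nat.mul_le_mul_right (f k) (Finset.le_sup hi)
    have hfloor : ∑ i, (⌊x * ((k : ℝ) * relDemand n α d i /
          ((n i : ℝ) * (f k : ℝ) * totDemand n α d))⌋ : ℝ) * ((n i : ℝ) * (f k : ℝ))
        ≤ ∑ i, x * k / totDemand n α d * relDemand n α d i := by
      refine Finset.sum_le_sum fun i _ => ?_
      have hni : (0 : ℝ) < n i := Nat.cast_pos.2 (hn i)
      calc _ ≤ x * ((k : ℝ) * relDemand n α d i /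
            ((n i : ℝ) * (f k : ℝ) * totDemand n α d)) * ((n i : ℝ) * (f k : ℝ)) :=
            mul_le_mul_of_nonneg_right (Int.floor_le _) (by positivity)
        _ = _ := by field_simp
    have hxk : ∑ i, x * k / totDemand n α d * relDemand n α d i
        = k - ((Finset.univ.sup n : ℕ) : ℝ) * f k := by
      rw [← Finset.mul_sum]
      change x * k / totDemand n α d * totDemand n α d = _
      rw [div_mul_cancel₀ _ hT.ne', hx]
      field_simp
    linarith

/-- The number of virtual servers differs from its fluid value `k ϱ_i / (n_i f_k ϱ)` by a
bounded amount. -/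
theorem abs_srv_sub_le {C : ℕ} {n : Fin C → ℕ} (hn : ∀ i, 0 < n i) {α d : Fin C → ℝ}
    (hT : 0 < totDemand n α d) {f : ℕ → ℕ} {k : ℕ} (hf : 0 < f k) (hk : 0 < k)
    (h : ((Finset.univ.sup n : ℕ) : ℝ) * f k ≤ k) {i : Fin C} (hi : 0 < relDemand n α d i) :
    |(srv n α d f i k : ℝ) - relDemand n α d i / (n i * totDemand n α d) * (k / f k)|
      ≤ ((Finset.univ.sup n : ℕ) : ℝ) * (relDemand n α d i / (n i * totDemand n α d)) + 1 := by
  have hk' : (0 : ℝ) < k := Nat.cast_pos.2 hk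
  have hf' : (0 : ℝ) < f k := Nat.cast_pos.2 hf
  have hni : (0 : ℝ) < n i := Nat.cast_pos.2 (hn i)
  have hlow := one_sub_le_psi hn hT hf hk h
  have hup := psi_le_one n α d f k
  have h0 : 0 ≤ psi n α d f k := Real.sSup_nonneg fun _ hx => hx.1.1
  have ha : (k : ℝ) * relDemand n α d i / ((n i : ℝ) * (f k : ℝ) * totDemand n α d)
      = relDemand n α d i / (n i * totDemand n α d) * (k / f k) := by
    field_simp
  have hpos : 0 < relDemand n α d i / (n i * totDemand n α d) * (k / f k) := by positivity
  have hc : 0 < relDemand n α d i / (n i * totDemand n α d) := by positivity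
  have hcancel : ((Finset.univ.sup n : ℕ) : ℝ) * f k / k *
      (relDemand n α d i / (n i * totDemand n α d) * (k / f k))
      = ((Finset.univ.sup n : ℕ) : ℝ) * (relDemand n α d i / (n i * totDemand n α d)) := by
    field_simp
  unfold srv
  rw [ha]
  set c := relDemand n α d i / (n i * totDemand n α d)
  have hle := Nat.floor_le (mul_nonneg h0 hpos.le)
  have hlt := Nat.lt_floor_add_one (psi n α d f k * (c * (k / f k)))
  have hlow' := mul_le_mul_of_nonneg_right hlow hpos.le
  have hup' := mul_le_mul_of_nonneg_right hup hpos.le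
  have hNc : 0 ≤ ((Finset.univ.sup n : ℕ) : ℝ) * c := by positivity
  rw [sub_mul, hcancel] at hlow'
  rw [abs_le]
  constructor <;> linarith

/-- If `(1 - r) √t → θ ≠ 0` with `t → ∞`, then perturbing the capacity `c t` by a bounded
amount does not change `1 - r` to first order. -/
theorem tendsto_one_sub_div_one_sub {ι : Type*} {l : Filter ι} {r t s : ι → ℝ} {θ c K : ℝ}
    (hθ : θ ≠ 0) (hc : c ≠ 0) (ht : Tendsto t l atTop)
    (hr : Tendsto (fun k => (1 - r k) * √(t k)) l (𝓝 θ))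
    (hs : ∀ᶠ k in l, |s k - c * t k| ≤ K) :
    Tendsto (fun k => (1 - r k * (c * t k) / s k) / (1 - r k)) l (𝓝 1) := by
  have hsqrt : Tendsto (fun k => √(t k)) l atTop := Real.tendsto_sqrt_atTop.comp ht
  have hr1 : Tendsto r l (𝓝 1) := by
    have h : Tendsto (fun k => 1 - (1 - r k) * √(t k) / √(t k)) l (𝓝 (1 - 0)) :=
      tendsto_const_nhds.sub (hr.div_atTop hsqrt)
    rw [sub_zero] at h
    refine h.congr' ?_
    filter_upwards [hsqrt.eventually_gt_atTop 0] with k hk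
    field_simp
    ring
  have hdiff {g : ι → ℝ} (hg : Tendsto g l atTop) :
      Tendsto (fun k => (s k - c * t k) / g k) l (𝓝 0) := by
    refine squeeze_zero_norm' ?_ (tendsto_const_nhds.div_atTop hg : Tendsto (fun k => K / g k) l _)
    filter_upwards [hs, hg.eventually_gt_atTop 0] with k hk hgk
    rw [Real.norm_eq_abs, abs_div, abs_of_pos hgk]
    gcongr
  have hst : Tendsto (fun k => s k / t k) l (𝓝 c) := by
    have h := (hdiff ht).add_const c
    rw [zero_add] at h
    refine h.congr' ?_
    filter_upwards [ht.eventually_gt_atTop 0] with k hk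
    field_simp
    ring
  have hlim := (((hr1.div hr hθ).mul (hdiff hsqrt)).div hst hc).const_add 1
  simp only [mul_zero, zero_div, add_zero] at hlim
  refine hlim.congr' ?_
  filter_upwards [ht.eventually_gt_atTop 0, hr.eventually_ne hθ, hst.eventually_ne hc]
    with k htk hrk hsk
  have h1 : 1 - r k ≠ 0 := left_ne_zero_of_mul hrk
  have h2 : s k ≠ 0 := (div_ne_zero_iff.1 hsk).1
  have h3 : √(t k) ≠ 0 := right_ne_zero_of_mul hrk
  have h4 : √(t k) ^ 2 = t k := Real.sq_sqrt htk.le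
  simp only [Pi.div_apply]
  field_simp
  rw [h4]
  field_simp
  ring

/-- In the critically loaded regime, (1 - ρ_i^(k))/(1 - ρ^(k)) → 1 for each class i,
where ρ_i^(k) = λ^(k) α_i d_i / s_i^(k) and ρ^(k) = λ^(k) ϱ f_k / k. -/
theorem classLoad_ratio_tendsto_one
    (C : ℕ) (hC : 0 < C) (n : Fin C → ℕ) (hn : ∀ i, 0 < n i)
    (α d : Fin C → ℝ) (hα : ∀ i, 0 < α i) (hd : ∀ i, 0 < d i)
    (hsum : ∑ i, α i = 1)
    (f : ℕ → ℕ) (hf : ∀ k, 0 < f k)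
    (hfk : Tendsto (fun k : ℕ => (f k : ℝ) / k) atTop (𝓝 0))
    (θ : ℝ) (hθ : 0 < θ) (lam : ℕ → ℝ) (hlam : ∀ k, 0 < lam k)
    (hcrit : Tendsto
      (fun k : ℕ => (1 - lam k * totDemand n α d * f k / k) * Real.sqrt ((k : ℝ) / f k))
      atTop (𝓝 θ))
    (i : Fin C) :
    Tendsto
      (fun k : ℕ =>
        (1 - lam k * α i * d i / (srv n α d f i k : ℝ)) /
          (1 - lam k * totDemand n α d * f k / k))
      atTop (𝓝 1) := by
  have hT := totDemand_pos hC hn hα hd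
  have hni : (0 : ℝ) < n i := Nat.cast_pos.2 (hn i)
  have hi : 0 < relDemand n α d i := mul_pos (mul_pos (hα i) (hd i)) hni
  have hc : 0 < relDemand n α d i / (n i * totDemand n α d) := by positivity
  have ht : Tendsto (fun k : ℕ => (k : ℝ) / f k) atTop atTop := by
    have h : Tendsto (fun k : ℕ => (f k : ℝ) / k) atTop (𝓝[>] 0) := by
      refine tendsto_nhdsWithin_iff.2 ⟨hfk, ?_⟩
      filter_upwards [eventually_gt_atTop 0] with k hk
      have hk' : (0 : ℝ) < k := Nat.cast_pos.2 hk
      have hf' : (0 : ℝ) < f k := Nat.cast_pos.2 (hf k)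
      exact div_pos hf' hk'
    exact h.inv_tendsto_nhdsGT_zero.congr fun k => inv_div _ _
  have hs : ∀ᶠ k in atTop,
      |(srv n α d f i k : ℝ) - relDemand n α d i / (n i * totDemand n α d) * (k / f k)|
        ≤ ((Finset.univ.sup n : ℕ) : ℝ) * (relDemand n α d i / (n i * totDemand n α d)) + 1 := by
    filter_upwards [eventually_gt_atTop 0,
      ht.eventually_ge_atTop ((Finset.univ.sup n : ℕ) : ℝ)] with k hk hkN
    exact abs_srv_sub_le hn hT (hf k) hk ((le_div_iff₀ (Nat.cast_pos.2 (hf k))).1 hkN) hi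
  refine (tendsto_one_sub_div_one_sub hθ.ne' hc.ne' ht hcrit hs).congr' ?_
  filter_upwards [eventually_gt_atTop 0] with k hk
  have hk' : (0 : ℝ) < k := Nat.cast_pos.2 hk
  have hf' : (0 : ℝ) < f k := Nat.cast_pos.2 (hf k)
  have hload : lam k * totDemand n α d * f k / k *
      (relDemand n α d i / (n i * totDemand n α d) * (k / f k)) = lam k * α i * d i := by
    unfold relDemand
    field_simp
  rw [hload]
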